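/- arXiv:1309.3381 — 3 statements merged into one kernel-verified Lean document; each statement's English description precedes it below -/
import Mathlib

section
/- Two finitely generated Abelian groups of non-zero rank admit equal growth functions with respect to finite monoid generating sets if and only if they have the same rank. That is, for finitely generated Abelian groups G and G' with rk G ≥ 1 and rk G' ≥ 1, there exist finite monoid generating sets S ⊆ G and S' ⊆ G' with β_{G,S} = β_{G',S'} if and only if rk G = rk G'. -/
/-- `S` is a monoid generating set of the group `G`: every element of `G` is a
product of finitely many elements of `S`. -/
def IsMonGenSet {G : Type*} [Group G] (S : Set G) : Prop := Submonoid.closure S = ⊤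

/-- `S` is symmetric: closed under inverses. -/
def IsSymmSet {G : Type*} [Group G] (S : Set G) : Prop := ∀ s ∈ S, s⁻¹ ∈ S

/-- The word length of `g` with respect to `S`: the least `n` such that `g` is a
product of `n` elements of `S`. -/
noncomputable def wlen {G : Type*} [Group G] (S : Set G) (g : G) : ℕ :=
  sInf {n | ∃ l : List G, (∀ x ∈ l, x ∈ S) ∧ l.length = n ∧ l.prod = g}

/-- The growth function `β_{G,S}`: the cardinality of the ball of radius `r`. -/
noncomputable def growth {G : Type*} [Group G] (S : Set G) (r : ℕ) : ℕ :=
  Set.ncard {g : G | wlen S g ≤ r}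

/-- The spherical growth function `σ_{G,S}`. -/
noncomputable def sph {G : Type*} [Group G] (S : Set G) (r : ℕ) : ℕ :=
  Set.ncard {g : G | wlen S g = r}

/-- The standard symmetric generating set `E_d ∪ (-E_d)` of `ℤ^d`. -/
def stdSymmSet (d : ℕ) : Set (Multiplicative (Fin d → ℤ)) :=
  {x | ∃ i : Fin d, x = Multiplicative.ofAdd (Pi.single i 1) ∨
       x = Multiplicative.ofAdd (-Pi.single i 1)}

/-- The standard symmetric growth function `β_d` of `ℤ^d`. -/
noncomputable def betaStd (d : ℕ) : ℕ → ℕ := growth (stdSymmSet d)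

/-- The standard monoid generating set `E_d ∪ {v_d}` of `ℤ^d`. -/
def stdMonSet (d : ℕ) : Set (Multiplicative (Fin d → ℤ)) :=
  {x | (∃ i : Fin d, x = Multiplicative.ofAdd (Pi.single i 1)) ∨
       x = Multiplicative.ofAdd (fun _ => (-1 : ℤ))}

/-- The standard monoid growth function `β⁺_d` of `ℤ^d`. -/
noncomputable def betaPlus (d : ℕ) : ℕ → ℕ := growth (stdMonSet d)

/-- The rank of a finitely generated abelian group. -/
noncomputable def rk (G : Type*) [CommGroup G] : ℕ := Module.finrank ℤ (Additive G)

open scoped Pointwise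

section Balls

variable {G : Type*} [Group G] {S : Set G}

lemma list_prod_mem_pow {l : List G} (hl : ∀ x ∈ l, x ∈ S) : l.prod ∈ S ^ l.length := by
  induction l with
  | nil => simp
  | cons a l ih =>
    rw [List.prod_cons, List.length_cons, pow_succ']
    exact Set.mul_mem_mul (hl a (by simp)) (ih fun x hx => hl x (by simp [hx]))

lemma mem_insert_one_pow_iff {r : ℕ} {g : G} :
    g ∈ (insert 1 S) ^ r ↔ ∃ l : List G, (∀ x ∈ l, x ∈ S) ∧ l.length ≤ r ∧ l.prod = g := by
  constructor
  · induction r generalizing g with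
    | zero =>
      intro h
      exact ⟨[], by simp, by simp, by simpa using h.symm⟩
    | succ r ih =>
      rw [pow_succ']
      rintro ⟨a, ha, b, hb, rfl⟩
      obtain ⟨l, hl, hlr, rfl⟩ := ih hb
      rcases ha with rfl | ha
      · exact ⟨l, hl, by omega, by simp⟩
      · exact ⟨a :: l, by simpa using ⟨ha, hl⟩, by simpa using hlr, by simp⟩
  · rintro ⟨l, hl, hlr, rfl⟩
    exact Set.pow_subset_pow_right (Set.mem_insert 1 S) hlr
      (list_prod_mem_pow fun x hx => Set.mem_insert_of_mem 1 (hl x hx))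

lemma wlen_le_iff (hS : IsMonGenSet S) {r : ℕ} {g : G} :
    wlen S g ≤ r ↔ g ∈ (insert 1 S) ^ r := by
  rw [mem_insert_one_pow_iff]
  have hg : g ∈ Submonoid.closure S := by rw [hS]; trivial
  obtain ⟨l, hl, hlg⟩ := Submonoid.exists_list_of_mem_closure hg
  constructor
  · intro h
    obtain ⟨l, hl, hlr, hlg⟩ := Nat.sInf_mem
      (s := {n | ∃ l : List G, (∀ x ∈ l, x ∈ S) ∧ l.length = n ∧ l.prod = g})
      ⟨l.length, l, hl, rfl, hlg⟩
    exact ⟨l, hl, hlr.trans_le h, hlg⟩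
  · rintro ⟨l, hl, hlr, hlg⟩
    exact (show wlen S g ≤ l.length from Nat.sInf_le ⟨l, hl, rfl, hlg⟩).trans hlr

lemma growth_eq_ncard_pow (hS : IsMonGenSet S) (r : ℕ) :
    growth S r = ((insert 1 S) ^ r : Set G).ncard := by
  unfold growth
  congr 1
  ext g
  exact wlen_le_iff hS

lemma finite_insert_one_pow (hS : S.Finite) (r : ℕ) : ((insert 1 S) ^ r : Set G).Finite := by
  induction r with
  | zero => simp
  | succ r ih =>
    rw [pow_succ]
    exact ih.mul (hS.insert 1)

lemma exists_subset_insert_one_pow (hS : IsMonGenSet S) {P : Set G} (hP : P.Finite) :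
    ∃ a : ℕ, P ⊆ (insert 1 S) ^ a := by
  obtain ⟨a, ha⟩ := (hP.image (wlen S)).bddAbove
  exact ⟨a, fun g hg => (wlen_le_iff hS).1 (ha (Set.mem_image_of_mem _ hg))⟩

end Balls

section Coordinates

variable {G A : Type*} [CommGroup G] [AddCommGroup A]

lemma setOf_mem_eq_pow (e : Additive G ≃+ A) {Q : ℕ → Set A} (h0 : Q 0 = {0})
    (hs : ∀ r, Q (r + 1) = Q r + Q 1) (r : ℕ) :
    {g | e (.ofMul g) ∈ Q r} = {g | e (.ofMul g) ∈ Q 1} ^ r := by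
  induction r with
  | zero =>
    ext g
    simp [h0]
  | succ r ih =>
    rw [pow_succ, ← ih, hs]
    ext g
    constructor
    · rintro ⟨x, hx, y, hy, hxy⟩
      refine ⟨(e.symm x).toMul, by simpa using hx, (e.symm y).toMul, by simpa using hy, ?_⟩
      apply Additive.ofMul.injective
      apply e.injective
      simpa using hxy
    · rintro ⟨x, hx, y, hy, rfl⟩
      exact ⟨_, hx, _, hy, by simp⟩

lemma ncard_setOf_mem (e : Additive G ≃+ A) (Q : Set A) :
    {g | e (.ofMul g) ∈ Q}.ncard = Q.ncard := by
  have : {g | e (.ofMul g) ∈ Q} = (Additive.ofMul.trans e.toEquiv) ⁻¹' Q := rfl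
  rw [this, ← Equiv.image_symm_eq_preimage, Set.ncard_image_of_injective _ (Equiv.injective _)]

lemma exists_addEquiv_prod_finite (G : Type*) [CommGroup G] (hG : Group.FG G) :
    ∃ (T : Type) (_ : AddCommGroup T) (_ : Finite T),
      Nonempty (Additive G ≃+ (Fin (rk G) → ℤ) × T) := by
  obtain ⟨n, ι, _, p, hp, k, ⟨f⟩⟩ := AddCommGroup.equiv_free_prod_directSum_zmod (Additive G)
  classical
  have : ∀ i, NeZero (p i ^ k i) := fun i => ⟨pow_ne_zero _ (hp i).ne_zero⟩
  let f' : Additive G ≃+ (Fin n → ℤ) × ((i : ι) → ZMod (p i ^ k i)) :=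
    f.trans (AddEquiv.prodCongr (Finsupp.linearEquivFunOnFinite ℤ ℤ (Fin n)).toAddEquiv
      (DirectSum.addEquivProd _))
  have hn : rk G = n := by
    unfold rk
    rw [LinearEquiv.finrank_eq f'.toIntLinearEquiv,
      ← Submodule.finrank_quotient_add_finrank (LinearMap.ker (LinearMap.fst ℤ (Fin n → ℤ) _)),
      LinearEquiv.finrank_eq (LinearMap.quotKerEquivOfSurjective _ LinearMap.fst_surjective),
      Module.finrank_fin_fun,
      Module.finrank_eq_zero_iff_isTorsion.2, add_zero]
    rintro ⟨⟨v, t⟩, hv⟩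
    obtain rfl : v = 0 := hv
    refine ⟨⟨(Nat.card ((i : ι) → ZMod (p i ^ k i)) : ℤ), ?_⟩, ?_⟩
    · exact mem_nonZeroDivisors_of_ne_zero (by exact_mod_cast Nat.card_pos.ne')
    · ext1
      simp only [Submonoid.mk_smul]
      refine Prod.ext (by simp) ?_
      simpa using card_nsmul_eq_zero' (x := t)
  exact ⟨_, inferInstance, inferInstance, ⟨hn ▸ f'⟩⟩

end Coordinates

section Degree

variable {G T : Type*} [CommGroup G] [AddCommGroup T] {S : Set G} {d : ℕ}

lemma insert_one_pow_subset_box (e : Additive G ≃+ (Fin d → ℤ) × T) (hS : S.Finite) :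
    ∃ m : ℕ, ∀ r : ℕ, (insert 1 S) ^ r ⊆
      {g | e (.ofMul g) ∈ Set.Icc (fun _ => -(m * r : ℤ)) (fun _ => (m * r : ℤ)) ×ˢ
        (Set.univ : Set T)} := by
  obtain ⟨m, hm⟩ := ((hS.insert 1).image
    fun g => ∑ i, ((e (.ofMul g)).1 i).natAbs).bddAbove
  have hm' : ∀ g ∈ insert 1 S, ∀ i, |(e (.ofMul g)).1 i| ≤ m := fun g hg i => by
    have h1 := hm ⟨g, hg, rfl⟩
    have h2 := Finset.single_le_sum (f := fun i => ((e (.ofMul g)).1 i).natAbs)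
      (fun _ _ => Nat.zero_le _) (Finset.mem_univ i)
    simp only at h1 h2
    rw [Int.abs_eq_natAbs]
    omega
  refine ⟨m, fun r => ?_⟩
  induction r with
  | zero =>
    rintro g rfl
    simp [Pi.le_def, -Set.Icc_self]
  | succ r ih =>
    rw [pow_succ]
    rintro _ ⟨x, hx, y, hy, rfl⟩
    have hx := ih hx
    simp only [Set.mem_ofPred_eq, Set.mem_prod, Set.mem_Icc, Pi.le_def, Set.mem_univ,
      and_true, ofMul_mul, map_add, Prod.fst_add, Pi.add_apply] at hx ⊢
    push_cast
    refine ⟨fun i => ?_, fun i => ?_⟩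
    · have := (abs_le.1 (hm' y hy i)).1
      linarith [hx.1 i]
    · have := (abs_le.1 (hm' y hy i)).2
      linarith [hx.2 i]

lemma growth_le [Finite T] (e : Additive G ≃+ (Fin d → ℤ) × T) (hS : S.Finite)
    (hgen : IsMonGenSet S) : ∃ K : ℕ, ∀ r, growth S r ≤ K * (r + 1) ^ d := by
  obtain ⟨m, hm⟩ := insert_one_pow_subset_box e hS
  refine ⟨(2 * m + 1) ^ d * Nat.card T, fun r => ?_⟩
  have hcard : (Set.Icc (fun _ : Fin d => -(m * r : ℤ)) (fun _ => (m * r : ℤ)) ×ˢ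
      (Set.univ : Set T)).ncard = (2 * (m * r) + 1) ^ d * Nat.card T := by
    rw [Set.ncard_prod, ← Finset.coe_Icc, Set.ncard_coe_finset, Pi.card_Icc, Set.ncard_univ]
    simp only [Int.card_Icc, Finset.prod_const, Finset.card_univ, Fintype.card_fin]
    congr 2
    zify
    rw [Int.toNat_of_nonneg (by linarith [show (0 : ℤ) ≤ m * r by positivity])]
    ring
  have hfin : {g | e (.ofMul g) ∈ Set.Icc (fun _ => -(m * r : ℤ)) (fun _ => (m * r : ℤ)) ×ˢ
      (Set.univ : Set T)}.Finite :=
    ((Set.finite_Icc _ _).prod Set.finite_univ).preimage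
      (Additive.ofMul.trans e.toEquiv).injective.injOn
  rw [growth_eq_ncard_pow hgen]
  calc _ ≤ _ := Set.ncard_le_ncard (hm r) hfin
    _ = (2 * (m * r) + 1) ^ d * Nat.card T := by rw [ncard_setOf_mem, hcard]
    _ ≤ ((2 * m + 1) * (r + 1)) ^ d * Nat.card T := by
      gcongr
      nlinarith
    _ = _ := by rw [mul_pow]; ring

lemma le_growth (e : Additive G ≃+ (Fin d → ℤ) × T) (hS : S.Finite)
    (hgen : IsMonGenSet S) : ∃ a : ℕ, ∀ r, (r + 1) ^ d ≤ growth S (a * r) := by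
  let Q : ℕ → Set ((Fin d → ℤ) × T) := fun r => Set.Icc 0 (fun _ => (r : ℤ)) ×ˢ {0}
  have h0 : Q 0 = {0} := by
    have : (fun _ : Fin d => ((0 : ℕ) : ℤ)) = 0 := by ext; simp
    simp only [Q, this, Set.Icc_self, Set.singleton_prod_singleton]
    rfl
  have hs : ∀ r, Q (r + 1) = Q r + Q 1 := by
    intro r
    ext ⟨v, t⟩
    simp only [Q, Set.mem_add, Prod.exists, Set.mem_prod, Set.mem_Icc, Pi.le_def,
      Set.mem_singleton_iff, Prod.mk_add_mk, Prod.mk.injEq]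
    constructor
    · rintro ⟨⟨h1, h2⟩, rfl⟩
      refine ⟨fun i => min (v i) r, 0, ⟨⟨fun i => ?_, fun i => ?_⟩, rfl⟩,
        fun i => v i - min (v i) r, 0, ⟨⟨fun i => ?_, fun i => ?_⟩, rfl⟩, ?_, by simp⟩
      · have := h1 i
        simp only [Pi.zero_apply] at *
        omega
      · simp
      · simp
      · have := h2 i
        push_cast at *
        omega
      · ext i
        simp
    · rintro ⟨v, t, ⟨⟨h1, h2⟩, rfl⟩, w, u, ⟨⟨h3, h4⟩, rfl⟩, rfl, rfl⟩
      refine ⟨⟨fun i => add_nonneg (h1 i) (h3 i), fun i => ?_⟩, by simp⟩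
      have := h2 i
      have := h4 i
      push_cast at *
      simp only [Pi.add_apply]
      omega
  have hcard : ∀ r, (Q r).ncard = (r + 1) ^ d := by
    intro r
    rw [Set.ncard_prod, ← Finset.coe_Icc, Set.ncard_coe_finset, Pi.card_Icc]
    simp
  have hfin : {g | e (.ofMul g) ∈ Q 1}.Finite :=
    ((Set.finite_Icc _ _).prod (Set.finite_singleton _)).preimage
      (Additive.ofMul.trans e.toEquiv).injective.injOn
  obtain ⟨a, ha⟩ := exists_subset_insert_one_pow hgen hfin
  refine ⟨a, fun r => ?_⟩
  rw [← hcard, ← ncard_setOf_mem e, growth_eq_ncard_pow hgen, setOf_mem_eq_pow e h0 hs, pow_mul]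
  exact Set.ncard_le_ncard (Set.pow_subset_pow_left ha) (by
    rw [← pow_mul]
    exact finite_insert_one_pow hS _)

end Degree

lemma rk_le_of_growth_eq {G G' : Type*} [CommGroup G] [CommGroup G']
    (hG : Group.FG G) (hG' : Group.FG G') {S : Set G} {S' : Set G'} (hS : S.Finite)
    (hS' : S'.Finite) (hgen : IsMonGenSet S) (hgen' : IsMonGenSet S')
    (h : growth S = growth S') : rk G' ≤ rk G := by
  obtain ⟨T, _, _, ⟨e⟩⟩ := exists_addEquiv_prod_finite G hG
  obtain ⟨T', _, _, ⟨e'⟩⟩ := exists_addEquiv_prod_finite G' hG'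
  obtain ⟨K, hK⟩ := growth_le e hS hgen
  obtain ⟨a, ha⟩ := le_growth e' hS' hgen'
  by_contra! hlt
  set r := K * (a + 1) ^ rk G with hr
  have h1 : (r + 1) ^ (rk G + 1) ≤ r * (r + 1) ^ rk G :=
    calc (r + 1) ^ (rk G + 1) ≤ (r + 1) ^ rk G' := Nat.pow_le_pow_right (by omega) hlt
      _ ≤ growth S' (a * r) := ha r
      _ ≤ K * (a * r + 1) ^ rk G := by rw [← h]; exact hK _
      _ ≤ K * ((a + 1) * (r + 1)) ^ rk G := by gcongr; nlinarith
      _ = r * (r + 1) ^ rk G := by rw [hr, mul_pow, mul_assoc]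
  rw [pow_succ'] at h1
  have := Nat.le_of_mul_le_mul_right h1 (by positivity)
  omega

section Existence

/-- In `ℤ^m × ℤ × T`, the product of a cube of side `2r + 1` with the set of pairs `(x, t)` such
that `-kr ≤ x < kr`, or `x = kr` and `t = 0`. -/
def halfOpenBox (m : ℕ) (T : Type*) [AddCommGroup T] (k r : ℕ) :
    Set ((Fin m → ℤ) × ℤ × T) :=
  Set.Icc (fun _ => -(r : ℤ)) (fun _ => (r : ℤ)) ×ˢ
    (Set.Ico (-(k * r : ℤ)) (k * r) ×ˢ Set.univ ∪ {((k * r : ℤ), 0)})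

variable {m : ℕ} {T : Type*} [AddCommGroup T] {k : ℕ}

lemma mem_halfOpenBox {r : ℕ} {v : Fin m → ℤ} {x : ℤ} {t : T} :
    (v, x, t) ∈ halfOpenBox m T k r ↔ (∀ i, -(r : ℤ) ≤ v i ∧ v i ≤ r) ∧
      (-(k * r : ℤ) ≤ x ∧ x < k * r ∨ x = k * r ∧ t = 0) := by
  simp [halfOpenBox, Pi.le_def, forall_and, or_comm]

lemma halfOpenBox_zero : halfOpenBox m T k 0 = {0} := by
  ext ⟨v, x, t⟩
  rw [mem_halfOpenBox]
  simp only [CharP.cast_eq_zero, mul_zero, neg_zero, Set.mem_singleton_iff, Prod.mk_eq_zero,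
    funext_iff, Pi.zero_apply]
  refine and_congr (forall_congr' fun i => by omega) ?_
  constructor
  · rintro (h | h)
    · omega
    · exact h
  · exact Or.inr

lemma halfOpenBox_succ (hk : 0 < k) (r : ℕ) :
    halfOpenBox m T k (r + 1) = halfOpenBox m T k r + halfOpenBox m T k 1 := by
  ext ⟨v, x, t⟩
  simp only [Set.mem_add, Prod.exists, Prod.mk_add_mk, Prod.mk.injEq, mem_halfOpenBox]
  push_cast
  have hkr : (0 : ℤ) ≤ k * r := by positivity
  rw [mul_add, mul_one]
  generalize (k * r : ℤ) = c at *
  constructor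
  · rintro ⟨hv, hx⟩
    have key : ∃ y u, (-c ≤ y ∧ y < c ∨ y = c ∧ u = 0) ∧ ∃ z w,
        (-(k : ℤ) ≤ z ∧ z < k ∨ z = k ∧ w = (0 : T)) ∧ y + z = x ∧ u + w = t := by
      rcases hx with hx | ⟨rfl, rfl⟩
      · by_cases h1 : (k : ℤ) ≤ x
        · exact ⟨x - k, t, Or.inl (by omega), k, 0, Or.inr ⟨rfl, rfl⟩, by simp, by simp⟩
        by_cases h2 : -(k : ℤ) ≤ x
        · rcases hkr.eq_or_lt with h3 | h3
          · exact ⟨0, 0, Or.inr ⟨h3, rfl⟩, x, t, Or.inl (by omega), by simp, by simp⟩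
          · exact ⟨0, 0, Or.inl (by omega), x, t, Or.inl (by omega), by simp, by simp⟩
        · exact ⟨x + k, t, Or.inl (by omega), -k, 0, Or.inl (by omega), by simp, by simp⟩
      · exact ⟨c, 0, Or.inr ⟨rfl, rfl⟩, k, 0, Or.inr ⟨rfl, rfl⟩, rfl, by simp⟩
    obtain ⟨y, u, h1, z, w, h2, h3, h4⟩ := key
    refine ⟨fun i => max (-(r : ℤ)) (min r (v i)), y, u, ⟨fun i => ?_, h1⟩,
      fun i => v i - max (-(r : ℤ)) (min r (v i)), z, w, ⟨fun i => ?_, by simpa using h2⟩,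
      by ext; simp, h3, h4⟩
    · constructor <;> dsimp only <;> omega
    · have := hv i
      constructor <;> dsimp only <;> omega
  · rintro ⟨v, y, u, ⟨hv, h1⟩, w, z, s, ⟨hw, h2⟩, rfl, rfl, rfl⟩
    refine ⟨fun i => ?_, ?_⟩
    · have := hv i
      have := hw i
      simp only [Pi.add_apply]
      omega
    · rcases h1 with h1 | ⟨rfl, rfl⟩
      · left
        omega
      · rcases h2 with h2 | ⟨rfl, rfl⟩
        · left
          omega
        · right
          simp

lemma finite_halfOpenBox [Finite T] (r : ℕ) : (halfOpenBox m T k r).Finite :=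
  (Set.finite_Icc _ _).prod
    (((Set.finite_Ico _ _).prod Set.finite_univ).union (Set.finite_singleton _))

lemma ncard_halfOpenBox [Finite T] (r : ℕ) :
    (halfOpenBox m T k r).ncard = (2 * r + 1) ^ m * (2 * (k * Nat.card T) * r + 1) := by
  rw [halfOpenBox, Set.ncard_prod, Set.ncard_union_eq (by simp)
    ((Set.finite_Ico _ _).prod Set.finite_univ) (Set.finite_singleton _), Set.ncard_prod,
    Set.ncard_singleton, ← Finset.coe_Icc, ← Finset.coe_Ico, Set.ncard_coe_finset,
    Set.ncard_coe_finset, Pi.card_Icc, Set.ncard_univ]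
  simp only [Int.card_Icc, Int.card_Ico, Finset.prod_const, Finset.card_univ, Fintype.card_fin]
  have h1 : ((r : ℤ) + 1 - -r).toNat = 2 * r + 1 := by omega
  have h2 : ((k * r : ℤ) - -(k * r)).toNat = 2 * (k * r) := by
    zify
    rw [Int.toNat_of_nonneg (by linarith [show (0 : ℤ) ≤ k * r by positivity])]
    ring
  rw [h1, h2]
  ring

lemma exists_mem_halfOpenBox (hk : 0 < k) (p : (Fin m → ℤ) × ℤ × T) :
    ∃ r, p ∈ halfOpenBox m T k r := by
  obtain ⟨v, x, t⟩ := p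
  refine ⟨∑ i, (v i).natAbs + x.natAbs + 1, mem_halfOpenBox.2 ⟨fun i => ?_, Or.inl ?_⟩⟩
  · have := Finset.single_le_sum (f := fun i => (v i).natAbs)
      (fun _ _ => Nat.zero_le _) (Finset.mem_univ i)
    omega
  · have : (x.natAbs + 1) ≤ k * (∑ i, (v i).natAbs + x.natAbs + 1) :=
      le_mul_of_one_le_of_le hk (by omega)
    zify at this
    constructor
    · push_cast
      linarith [neg_abs_le x]
    · push_cast
      linarith [le_abs_self x]

lemma exists_growth_eq {G : Type*} [CommGroup G] [Finite T]
    (e : Additive G ≃+ (Fin m → ℤ) × ℤ × T) (hk : 0 < k) :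
    ∃ S : Set G, S.Finite ∧ IsMonGenSet S ∧
      ∀ r, growth S r = (2 * r + 1) ^ m * (2 * (k * Nat.card T) * r + 1) := by
  have hpow := setOf_mem_eq_pow e (halfOpenBox_zero (m := m) (T := T) (k := k))
    (halfOpenBox_succ hk)
  set S : Set G := {g | e (.ofMul g) ∈ halfOpenBox m T k 1} with hSdef
  have hgen : IsMonGenSet S := by
    refine (Submonoid.eq_top_iff' _).2 fun g => ?_
    obtain ⟨r, hr⟩ := exists_mem_halfOpenBox hk (e (.ofMul g))
    have hg : g ∈ S ^ r := hpow r ▸ hr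
    exact Submonoid.pow_subset Submonoid.subset_closure hg
  have h1 : (1 : G) ∈ S := by
    simp only [hSdef, Set.mem_ofPred_eq, ofMul_one, map_zero]
    exact mem_halfOpenBox.2 ⟨fun i => by simp, Or.inl (by simpa using hk)⟩
  refine ⟨S, (finite_halfOpenBox 1).preimage
    (Additive.ofMul.trans e.toEquiv).injective.injOn, hgen, fun r => ?_⟩
  rw [growth_eq_ncard_pow hgen, Set.insert_eq_of_mem h1, ← hpow, ncard_setOf_mem,
    ncard_halfOpenBox]

/-- Splits off the first coordinate of `ℤ^(m+1)` and moves it to the second factor. -/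
def splitFirstCoordinate (m : ℕ) (T : Type*) [AddCommGroup T] :
    (Fin (m + 1) → ℤ) × T ≃+ (Fin m → ℤ) × ℤ × T :=
  (AddEquiv.prodCongr
    ((Fin.consLinearEquiv ℤ (fun _ : Fin (m + 1) => ℤ)).symm.toAddEquiv.trans AddEquiv.prodComm)
    (AddEquiv.refl T)).trans AddEquiv.prodAssoc

end Existence

/-- Two finitely generated Abelian groups of non-zero rank admit equal growth
functions with respect to finite monoid generating sets iff they have the same rank. -/
theorem abelian_equal_growth_monoid_iff (G G' : Type*) [CommGroup G] [CommGroup G']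
    (hG : Group.FG G) (hG' : Group.FG G') (h1 : 1 ≤ rk G) (h1' : 1 ≤ rk G') :
    (∃ (S : Set G) (S' : Set G'), S.Finite ∧ S'.Finite ∧
        IsMonGenSet S ∧ IsMonGenSet S' ∧ growth S = growth S') ↔
      rk G = rk G' := by
  constructor
  · rintro ⟨S, S', hS, hS', hgen, hgen', h⟩
    exact le_antisymm (rk_le_of_growth_eq hG' hG hS' hS hgen' hgen h.symm)
      (rk_le_of_growth_eq hG hG' hS hS' hgen hgen' h)
  · intro h
    obtain ⟨T, _, _, ⟨e⟩⟩ := exists_addEquiv_prod_finite G hG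
    obtain ⟨T', _, _, ⟨e'⟩⟩ := exists_addEquiv_prod_finite G' hG'
    obtain ⟨m, hm⟩ := Nat.exists_eq_add_of_le' h1
    rw [← h, hm] at e'
    rw [hm] at e
    obtain ⟨S, hS, hgen, hgr⟩ :=
      exists_growth_eq (e.trans (splitFirstCoordinate m T)) (Nat.card_pos (α := T'))
    obtain ⟨S', hS', hgen', hgr'⟩ :=
      exists_growth_eq (e'.trans (splitFirstCoordinate m T')) (Nat.card_pos (α := T))
    refine ⟨S, S', hS, hS', hgen, hgen', funext fun r => ?_⟩
    rw [hgr, hgr', mul_comm (Nat.card T')]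
end

section
/- For every function β : ℕ → ℕ there are at most finitely many isomorphism types of finitely generated Abelian groups G admitting a finite monoid generating set S with β_{G,S} = β. Equivalently, the set of isomorphism classes of finitely generated Abelian groups G such that some finite monoid generating set S of G satisfies β_{G,S} = β is finite. -/
/-- A bundled commutative group (used to state finiteness of isomorphism types). -/
structure BundledCommGroup where
  carrier : Type
  [str : CommGroup carrier]

instance (X : BundledCommGroup) : CommGroup X.carrier := X.str

section WordLength

variable {G : Type*} [Group G] {S : Set G}

theorem IsMonGenSet.exists_list (hS : IsMonGenSet S) (g : G) :
    ∃ l : List G, (∀ x ∈ l, x ∈ S) ∧ l.length = wlen S g ∧ l.prod = g := by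
  have hg : g ∈ Submonoid.closure S := by rw [hS]; trivial
  obtain ⟨l, hl, hp⟩ := Submonoid.exists_list_of_mem_closure hg
  exact Nat.sInf_mem (s := {n | ∃ l : List G, (∀ x ∈ l, x ∈ S) ∧ l.length = n ∧ l.prod = g})
    ⟨l.length, l, hl, rfl, hp⟩

theorem wlen_list_prod_le {l : List G} (hl : ∀ x ∈ l, x ∈ S) : wlen S l.prod ≤ l.length :=
  Nat.sInf_le ⟨l, hl, rfl, rfl⟩

theorem wlen_one : wlen S (1 : G) = 0 := by
  simpa using wlen_list_prod_le (S := S) (l := []) (by simp)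

theorem wlen_le_one_of_mem {s : G} (hs : s ∈ S) : wlen S s ≤ 1 := by
  simpa using wlen_list_prod_le (S := S) (l := [s]) (by simpa using hs)

theorem IsMonGenSet.wlen_mul_le (hS : IsMonGenSet S) (g h : G) :
    wlen S (g * h) ≤ wlen S g + wlen S h := by
  obtain ⟨l, hl, hlen, hp⟩ := hS.exists_list g
  obtain ⟨m, hm, hmlen, hq⟩ := hS.exists_list h
  have := wlen_list_prod_le (S := S) (l := l ++ m)
    (fun x hx => (List.mem_append.1 hx).elim (hl x) (hm x))
  simpa [hlen, hmlen, hp, hq] using this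

theorem IsMonGenSet.wlen_pow_le (hS : IsMonGenSet S) (g : G) (n : ℕ) :
    wlen S (g ^ n) ≤ n * wlen S g := by
  induction n with
  | zero => simp [wlen_one]
  | succ n ih =>
    rw [pow_succ, Nat.succ_mul]
    exact (hS.wlen_mul_le _ _).trans (Nat.add_le_add_right ih _)

/-- Balls with respect to a finite generating set are finite. -/
theorem IsMonGenSet.finite_ball (hS : IsMonGenSet S) (hfin : S.Finite) (r : ℕ) :
    {g : G | wlen S g ≤ r}.Finite := by
  induction r with
  | zero =>
    refine (Set.finite_singleton (1 : G)).subset fun g hg => ?_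
    obtain ⟨l, -, hlen, rfl⟩ := hS.exists_list g
    have : l = [] := List.length_eq_zero_iff.1 (hlen.trans (Nat.le_zero.1 hg))
    simp [this]
  | succ r ih =>
    refine (ih.union (Set.Finite.image2 (· * ·) hfin ih)).subset fun g hg => ?_
    obtain ⟨l, hl, hlen, rfl⟩ := hS.exists_list g
    cases l with
    | nil => exact Or.inl (by simp [wlen_one])
    | cons s l =>
      refine Or.inr ⟨s, hl s (by simp), l.prod, ?_, by simp⟩
      have h1 := wlen_list_prod_le (S := S) (l := l) (fun x hx => hl x (by simp [hx]))
      simp only [Set.mem_ofPred_eq] at hg ⊢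
      simp only [List.length_cons] at hlen
      omega

end WordLength

theorem IsMonGenSet.wlen_prod_pow_le {G ι : Type*} [CommGroup G] {S : Set G}
    (hS : IsMonGenSet S) (f : ι → G) (hf : ∀ i, wlen S (f i) ≤ 1) (u : ι → ℕ) (t : Finset ι) :
    wlen S (∏ i ∈ t, f i ^ u i) ≤ ∑ i ∈ t, u i := by
  classical
  induction t using Finset.induction_on with
  | empty => simp [wlen_one]
  | insert a t ha ih =>
    rw [Finset.prod_insert ha, Finset.sum_insert ha]
    have h1 := hS.wlen_pow_le (f a) (u a)
    have h2 := Nat.mul_le_mul_left (u a) (hf a)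
    have h3 := hS.wlen_mul_le (f a ^ u a) (∏ i ∈ t, f i ^ u i)
    omega

theorem exists_list_prod_eq_prod_pow {G ι : Type*} [CommGroup G] [Fintype ι] (f : ι → G)
    (l : List G) (hl : ∀ x ∈ l, x ∈ Set.range f) :
    ∃ u : ι → ℕ, ∑ i, u i = l.length ∧ ∏ i, f i ^ u i = l.prod := by
  classical
  induction l with
  | nil => exact ⟨0, by simp, by simp⟩
  | cons x l ih =>
    obtain ⟨u, hu, hp⟩ := ih fun y hy => hl y (by simp [hy])
    obtain ⟨i, rfl⟩ := hl x (by simp)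
    refine ⟨u + Pi.single i 1, ?_, ?_⟩
    · simp [Finset.sum_add_distrib, hu]
    · have hi : ∏ j, f j ^ (Pi.single i 1 : ι → ℕ) j = f i := by
        rw [Fintype.prod_eq_single i fun j hj => by simp [hj]]
        simp
      simp [pow_add, Finset.prod_mul_distrib, hp, hi, mul_comm]

/-- The points of `ℕ^k` with coordinate sum at most `r`, viewed inside `ℤ^k`. -/
def natSimplex (k r : ℕ) : Set (Fin k → ℤ) :=
  (fun (u : Fin k → ℕ) i => (u i : ℤ)) '' {u | ∑ i, u i ≤ r}

theorem natSimplex_finite (k r : ℕ) : (natSimplex k r).Finite := by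
  refine ((Set.finite_Iic (fun _ : Fin k => r)).subset fun u hu i => ?_).image _
  exact (Finset.single_le_sum (f := u) (fun _ _ => Nat.zero_le _) (Finset.mem_univ i)).trans hu

theorem exists_eq_sub_of_natSimplex {k : ℕ} (a : Fin k → ℤ) :
    ∃ r, ∃ u ∈ natSimplex k r, ∃ v ∈ natSimplex k r, a = u - v := by
  refine ⟨∑ i, (a i).toNat + ∑ i, (-a i).toNat, _,
    ⟨fun i => (a i).toNat, Nat.le_add_right _ _, rfl⟩, _,
    ⟨fun i => (-a i).toNat, Nat.le_add_left _ _, rfl⟩, ?_⟩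
  funext i
  simp only [Pi.sub_apply]
  omega

theorem ncard_image_eq_of_eq_iff_eq {A X Y : Type*} {B : Set A} {f : A → X} {g : A → Y}
    (h : ∀ u ∈ B, ∀ v ∈ B, f u = f v ↔ g u = g v) : (f '' B).ncard = (g '' B).ncard := by
  refine Set.ncard_congr (fun x hx => g (Classical.choose hx)) ?_ ?_ ?_
  · exact fun x hx => ⟨_, (Classical.choose_spec hx).1, rfl⟩
  · intro x y hx hy hxy
    rw [← (Classical.choose_spec hx).2, ← (Classical.choose_spec hy).2]
    exact (h _ (Classical.choose_spec hx).1 _ (Classical.choose_spec hy).1).2 hxy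
  · rintro _ ⟨u, hu, rfl⟩
    have hx : f u ∈ f '' B := ⟨u, hu, rfl⟩
    exact ⟨f u, hx, (h _ (Classical.choose_spec hx).1 _ hu).1 (Classical.choose_spec hx).2⟩

/-- The number of cosets of `N` met by the simplex `natSimplex k r`. -/
noncomputable def cosetCount {k : ℕ} (N : AddSubgroup (Fin k → ℤ)) (r : ℕ) : ℕ :=
  ((QuotientAddGroup.mk : (Fin k → ℤ) → (Fin k → ℤ) ⧸ N) '' natSimplex k r).ncard

theorem eq_of_le_of_cosetCount_eq {k : ℕ} {L N : AddSubgroup (Fin k → ℤ)} (hLN : L ≤ N)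
    (h : ∀ r, cosetCount N r = cosetCount L r) : N = L := by
  refine le_antisymm (fun a ha => ?_) hLN
  obtain ⟨r, u, hu, v, hv, rfl⟩ := exists_eq_sub_of_natSimplex a
  let p : (Fin k → ℤ) ⧸ L →+ (Fin k → ℤ) ⧸ N :=
    QuotientAddGroup.map L N (AddMonoidHom.id _) hLN
  have hp : p '' (QuotientAddGroup.mk '' natSimplex k r) =
      QuotientAddGroup.mk '' natSimplex k r := by
    rw [Set.image_image]
    rfl
  have hinj := Set.injOn_of_ncard_image_eq (f := p)
    (s := QuotientAddGroup.mk '' natSimplex k r) (by rw [hp]; exact h r)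
    ((natSimplex_finite k r).image _)
  have hN : p (QuotientAddGroup.mk v) = p (QuotientAddGroup.mk u) := by
    refine QuotientAddGroup.eq.2 ?_
    simpa [neg_add_eq_sub] using ha
  have hL := QuotientAddGroup.eq.1 (hinj ⟨v, hv, rfl⟩ ⟨u, hu, rfl⟩ hN)
  simpa [neg_add_eq_sub] using hL

/-- The limit of an ultrafilter of subgroups. -/
def ultrafilterLimit {A : Type*} [AddCommGroup A] (U : Ultrafilter (AddSubgroup A)) :
    AddSubgroup A where
  carrier := {a | ∀ᶠ N in (U : Filter (AddSubgroup A)), a ∈ N}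
  zero_mem' := Filter.Eventually.of_forall fun N => N.zero_mem
  add_mem' ha hb := by
    filter_upwards [ha, hb] with N h1 h2 using N.add_mem h1 h2
  neg_mem' ha := by
    filter_upwards [ha] with N h using N.neg_mem h

theorem eventually_mem_iff_mem_ultrafilterLimit {A : Type*} [AddCommGroup A]
    (U : Ultrafilter (AddSubgroup A)) (a : A) :
    ∀ᶠ N in (U : Filter (AddSubgroup A)), (a ∈ N ↔ a ∈ ultrafilterLimit U) := by
  by_cases ha : a ∈ ultrafilterLimit U
  · have h : ∀ᶠ N in (U : Filter (AddSubgroup A)), a ∈ N := ha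
    filter_upwards [h] with N hN using iff_of_true hN ha
  · have h : ∀ᶠ N in (U : Filter (AddSubgroup A)), a ∉ N := Ultrafilter.eventually_not.2 ha
    filter_upwards [h] with N hN using iff_of_false hN ha

theorem eventually_ultrafilterLimit_le {A : Type*} [AddCommGroup A] [IsNoetherian ℤ A]
    (U : Ultrafilter (AddSubgroup A)) :
    ∀ᶠ N in (U : Filter (AddSubgroup A)), ultrafilterLimit U ≤ N := by
  obtain ⟨T, hT⟩ := (AddSubgroup.toIntSubmodule _).fg_iff_addSubgroup_fg.1
    (IsNoetherian.noetherian (AddSubgroup.toIntSubmodule (ultrafilterLimit U)))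
  rw [AddSubgroup.toIntSubmodule_toAddSubgroup] at hT
  have h : ∀ᶠ N in (U : Filter (AddSubgroup A)), ∀ a ∈ T, a ∈ N := by
    refine (Filter.eventually_all_finset T).2 fun a ha => ?_
    have : a ∈ ultrafilterLimit U := hT ▸ AddSubgroup.subset_closure ha
    exact this
  filter_upwards [h] with N hN
  rw [← hT]
  exact (AddSubgroup.closure_le N).2 hN

theorem eventually_cosetCount_eq {k : ℕ} (U : Ultrafilter (AddSubgroup (Fin k → ℤ))) (r : ℕ) :
    ∀ᶠ N in (U : Filter (AddSubgroup (Fin k → ℤ))),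
      cosetCount N r = cosetCount (ultrafilterLimit U) r := by
  have h : ∀ᶠ N in (U : Filter (AddSubgroup (Fin k → ℤ))),
      ∀ u ∈ natSimplex k r, ∀ v ∈ natSimplex k r,
        (-u + v ∈ N ↔ -u + v ∈ ultrafilterLimit U) := by
    refine (Filter.eventually_all_finite (natSimplex_finite k r)).2 fun u _ => ?_
    refine (Filter.eventually_all_finite (natSimplex_finite k r)).2 fun v _ => ?_
    exact eventually_mem_iff_mem_ultrafilterLimit U _
  filter_upwards [h] with N hN
  refine ncard_image_eq_of_eq_iff_eq fun u hu v hv => ?_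
  rw [QuotientAddGroup.eq, QuotientAddGroup.eq]
  exact hN u hu v hv

theorem finite_setOf_cosetCount_eq (k : ℕ) (β : ℕ → ℕ) :
    {N : AddSubgroup (Fin k → ℤ) | cosetCount N = β}.Finite := by
  by_contra hinf
  obtain ⟨U, hU, hcof⟩ : ∃ U : Ultrafilter (AddSubgroup (Fin k → ℤ)),
      {N | cosetCount N = β} ∈ U ∧ (U : Filter (AddSubgroup (Fin k → ℤ))) ≤ Filter.cofinite := by
    have := Filter.cofinite_inf_principal_neBot_iff.2 hinf
    obtain ⟨U, hU⟩ := Ultrafilter.exists_le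
      (Filter.cofinite ⊓ Filter.principal {N : AddSubgroup (Fin k → ℤ) | cosetCount N = β})
    exact ⟨U, Filter.le_principal_iff.1 (hU.trans inf_le_right), hU.trans inf_le_left⟩
  have hlim : ∀ r, cosetCount (ultrafilterLimit U) r = β r := fun r => by
    have hU' : ∀ᶠ N in (U : Filter (AddSubgroup (Fin k → ℤ))), cosetCount N = β := hU
    obtain ⟨N, h1, h2⟩ := ((eventually_cosetCount_eq U r).and hU').exists
    rw [← h1, h2]
  have hne : ∀ᶠ N in (U : Filter (AddSubgroup (Fin k → ℤ))), N ≠ ultrafilterLimit U :=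
    hcof (Set.finite_singleton _).compl_mem_cofinite
  obtain ⟨N, ⟨h1, h2⟩, h3⟩ := ((hne.and (eventually_ultrafilterLimit_le U)).and hU).exists
  have hN : cosetCount N = β := h3
  exact h1 (eq_of_le_of_cosetCount_eq h2 fun r => by rw [hlim, hN])

/-- A group with growth function `β` is a quotient of `ℤ^(β 1)` whose coset counts are `β`. -/
theorem exists_quotient_mulEquiv_of_growth_eq {G : Type*} [CommGroup G] {S : Set G}
    (hfin : S.Finite) (hS : IsMonGenSet S) :
    ∃ N : AddSubgroup (Fin (growth S 1) → ℤ), cosetCount N = growth S ∧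
      Nonempty (G ≃* Multiplicative ((Fin (growth S 1) → ℤ) ⧸ N)) := by
  have := (hS.finite_ball hfin 1).to_subtype
  let e : Fin (growth S 1) ≃ {g : G | wlen S g ≤ 1} := (Finite.equivFin _).symm
  let f : Fin (growth S 1) → G := fun i => e i
  have hf : ∀ i, wlen S (f i) ≤ 1 := fun i => (e i).2
  have hSf : S ⊆ Set.range f := fun s hs =>
    ⟨e.symm ⟨s, wlen_le_one_of_mem hs⟩, by simp [f]⟩
  let φ : (Fin (growth S 1) → ℤ) →+ Additive G :=
    AddMonoidHom.mk' (fun a => Additive.ofMul (∏ i, f i ^ a i)) fun a b => by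
      simp [zpow_add, Finset.prod_mul_distrib]
  have hball : ∀ r, φ '' natSimplex _ r = Additive.toMul ⁻¹' {g : G | wlen S g ≤ r} := by
    intro r
    ext x
    constructor
    · rintro ⟨_, ⟨u, hu, rfl⟩, rfl⟩
      have := hS.wlen_prod_pow_le f hf u Finset.univ
      simpa [φ] using this.trans hu
    · intro hx
      obtain ⟨l, hl, hlen, hp⟩ := hS.exists_list x.toMul
      obtain ⟨u, hu, hpu⟩ := exists_list_prod_eq_prod_pow f l fun y hy => hSf (hl y hy)
      refine ⟨_, ⟨u, (hu.trans hlen).le.trans hx, rfl⟩, ?_⟩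
      apply Additive.toMul.injective
      simpa [φ, hpu] using hp
  have hsurj : Function.Surjective φ := fun x => by
    have hx : x ∈ φ '' natSimplex _ (wlen S x.toMul) := by
      rw [hball]
      exact le_refl (wlen S x.toMul)
    obtain ⟨a, -, ha⟩ := hx
    exact ⟨a, ha⟩
  refine ⟨φ.ker, ?_, ⟨?_⟩⟩
  · funext r
    have h1 : cosetCount φ.ker r = (φ '' natSimplex _ r).ncard :=
      ncard_image_eq_of_eq_iff_eq fun u _ v _ => by
        rw [QuotientAddGroup.eq, AddMonoidHom.mem_ker, map_add, map_neg, neg_add_eq_zero]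
    rw [h1, hball]
    rfl
  · exact (AddEquiv.toMultiplicative
      (QuotientAddGroup.quotientKerEquivOfSurjective φ hsurj).symm :)

/-- Finite ambiguity: for every function `β : ℕ → ℕ` there are at most finitely
many isomorphism types of finitely generated Abelian groups `G` admitting a finite
monoid generating set `S` with `β_{G,S} = β`. -/
theorem finitely_many_abelian_groups_with_growth (β : ℕ → ℕ) :
    ∃ (n : ℕ) (H : Fin n → BundledCommGroup),
      ∀ (G : Type*) [CommGroup G], Group.FG G →
        (∃ S : Set G, S.Finite ∧ IsMonGenSet S ∧ growth S = β) →
        ∃ i, Nonempty (G ≃* (H i).carrier) := by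
  have := (finite_setOf_cosetCount_eq (β 1) β).to_subtype
  let e := Finite.equivFin {N : AddSubgroup (Fin (β 1) → ℤ) | cosetCount N = β}
  refine ⟨_, fun i => ⟨Multiplicative ((Fin (β 1) → ℤ) ⧸ (e.symm i).1)⟩, ?_⟩
  rintro G _ - ⟨S, hfin, hS, rfl⟩
  obtain ⟨N, hN, hiso⟩ := exists_quotient_mulEquiv_of_growth_eq hfin hS
  obtain ⟨i, hi⟩ := e.symm.surjective ⟨N, hN⟩
  obtain rfl : (e.symm i).1 = N := congrArg Subtype.val hi
  exact ⟨i, hiso⟩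
end

section
/- Let G be a finitely generated group and let I = { g ∈ G : g² = e } be the set of elements of order at most 2. If I is finite and S ⊆ G is a finite symmetric generating set of G, then for all r ∈ ℕ with r strictly greater than the diameter of I with respect to the word metric d_S, one has β_{G,S}(r) ≡ |I| (mod 2). -/
theorem IsMonGenSet.exists_list_length_eq_wlen {G : Type*} [Group G] {S : Set G}
    (hgen : IsMonGenSet S) (g : G) :
    ∃ l : List G, (∀ x ∈ l, x ∈ S) ∧ l.length = wlen S g ∧ l.prod = g := by
  have hg : g ∈ Submonoid.closure S := by
    rw [hgen]
    exact Submonoid.mem_top g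
  obtain ⟨l, hl, hprod⟩ := Submonoid.exists_list_of_mem_closure hg
  have hne : {n | ∃ l : List G, (∀ x ∈ l, x ∈ S) ∧ l.length = n ∧ l.prod = g}.Nonempty :=
    ⟨l.length, l, hl, rfl, hprod⟩
  exact Nat.sInf_mem hne

theorem wlen_prod_le_length {G : Type*} [Group G] {S : Set G} {l : List G}
    (hl : ∀ x ∈ l, x ∈ S) : wlen S l.prod ≤ l.length :=
  Nat.sInf_le ⟨l, hl, rfl, rfl⟩

theorem wlen_inv_le {G : Type*} [Group G] {S : Set G} (hsymm : IsSymmSet S)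
    (hgen : IsMonGenSet S) (g : G) : wlen S g⁻¹ ≤ wlen S g := by
  obtain ⟨l, hl, hlen, rfl⟩ := hgen.exists_list_length_eq_wlen g
  have hinv : ∀ x ∈ (l.map (·⁻¹)).reverse, x ∈ S := by
    simp only [List.mem_reverse, List.mem_map]
    rintro _ ⟨y, hy, rfl⟩
    exact hsymm y (hl y hy)
  calc wlen S l.prod⁻¹ = wlen S (l.map (·⁻¹)).reverse.prod := by rw [List.prod_inv_reverse]
    _ ≤ (l.map (·⁻¹)).reverse.length := wlen_prod_le_length hinv
    _ = wlen S l.prod := by simp [hlen]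

theorem finite_setOf_wlen_le {G : Type*} [Group G] {S : Set G} (hSfin : S.Finite)
    (hgen : IsMonGenSet S) (r : ℕ) : {g : G | wlen S g ≤ r}.Finite := by
  have := hSfin.to_subtype
  refine ((List.finite_length_le S r).image fun l ↦ (l.map Subtype.val).prod).subset ?_
  intro g hg
  obtain ⟨l, hl, hlen, rfl⟩ := hgen.exists_list_length_eq_wlen g
  have hlr : l.length ≤ r := hlen.trans_le hg
  lift l to List S using hl
  exact ⟨l, by simpa using hlr, rfl⟩

/-- A finite subset of a group that is closed under inverses has as many elements, modulo 2,
as it has elements of order at most 2. -/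
theorem Finset.card_modEq_two_card_filter_sq_eq_one {G : Type*} [Group G] [DecidableEq G]
    (B : Finset G) (hB : ∀ g ∈ B, g⁻¹ ∈ B) :
    B.card ≡ (B.filter fun g ↦ g ^ 2 = 1).card [MOD 2] := by
  have hsum : ∑ g ∈ B with ¬g ^ 2 = 1, (1 : ZMod 2) = 0 := by
    refine Finset.sum_involution (fun g _ ↦ g⁻¹) (fun _ _ ↦ by decide) ?_ ?_
      (fun g _ ↦ inv_inv g)
    · intro g hg _ h
      exact (Finset.mem_filter.mp hg).2 (by rw [sq, ← inv_eq_iff_mul_eq_one, h])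
    · intro g hg
      simpa using ⟨hB g (Finset.mem_filter.mp hg).1, (Finset.mem_filter.mp hg).2⟩
  rw [← ZMod.natCast_eq_natCast_iff,
    ← Finset.card_filter_add_card_filter_not (s := B) fun g ↦ g ^ 2 = 1]
  simpa using hsum

/-- Growth and elements of order 2 (Hainke–Scheele): if the set `I` of elements of
order at most 2 is finite and `S` is a finite symmetric generating set, then for
every radius `r` strictly larger than the diameter of `I` with respect to the word
metric `d_S`, the ball cardinality `β_{G,S}(r)` is congruent to `|I|` mod 2. -/
theorem growth_mod_two_eq_card_involutions (G : Type*) [Group G]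
    (S : Set G) (hSfin : S.Finite) (hsymm : IsSymmSet S) (hgen : IsMonGenSet S)
    (hI : {g : G | g ^ 2 = 1}.Finite) (r : ℕ)
    (hr : ∀ g ∈ {g : G | g ^ 2 = 1}, ∀ h ∈ {g : G | g ^ 2 = 1}, wlen S (h⁻¹ * g) < r) :
    growth S r % 2 = Nat.card {g : G | g ^ 2 = 1} % 2 := by
  classical
  have hball := finite_setOf_wlen_le hSfin hgen r
  have hinv : ∀ g ∈ hball.toFinset, g⁻¹ ∈ hball.toFinset := by
    simp only [Set.Finite.mem_toFinset, Set.mem_ofPred_eq]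
    exact fun g hg ↦ (wlen_inv_le hsymm hgen g).trans hg
  have hfilter : (hball.toFinset.filter fun g ↦ g ^ 2 = 1) = hI.toFinset := by
    ext g
    simp only [Finset.mem_filter, Set.Finite.mem_toFinset, Set.mem_ofPred_eq,
      and_iff_right_iff_imp]
    intro hg
    simpa using (hr g hg 1 (one_pow 2)).le
  rw [growth, Set.ncard_eq_toFinset_card _ hball, Nat.card_coe_set_eq,
    Set.ncard_eq_toFinset_card _ hI, ← hfilter]
  exact Finset.card_modEq_two_card_filter_sq_eq_one _ hinv
end
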